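/- (Penrose–Ruelle bound) Let V be a pair potential in dimension d, stable with stability constant B, and suppose C(β) = ∫_{ℝ^d} |e^{−βV(x)} − 1| dx < ∞ for β > 0. Then for every n ≥ 2 and every bounded measurable Λ ⊂ ℝ^d of positive volume, the n-th Mayer coefficient satisfies |C_n(β, Λ)| ≤ e^{2βB(n−2)} n^{n−2} C(β)^{n−1} / n!. Consequently, for every complex λ with |λ| < 1/(e^{2βB+1} C(β)), the series ∑_{n≥1} |C_n(β, Λ)| |λ|^n converges, uniformly in Λ. -/

import Mathlib

open MeasureTheory
open scoped BigOperators

noncomputable section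
open Classical

/-- The total pair interaction energy `∑_{1 ≤ i < j ≤ n} V (x i - x j)`. -/
def pairEnergy {d : ℕ} (V : EuclideanSpace ℝ (Fin d) → ℝ) {n : ℕ}
    (x : Fin n → EuclideanSpace ℝ (Fin d)) : ℝ :=
  ∑ p ∈ Finset.univ.filter (fun p : Fin n × Fin n => p.1 < p.2), V (x p.1 - x p.2)

/-- The edges of a simple graph on a linearly ordered vertex type, listed as ordered pairs
`(i, j)` with `i < j` (each unordered edge `{i,j}` appears exactly once). -/
def edgePairs {α : Type*} [Fintype α] [LinearOrder α] (g : SimpleGraph α) :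
    Finset (α × α) :=
  Finset.univ.filter fun p => p.1 < p.2 ∧ g.Adj p.1 p.2

/-- The Ursell function
`Φ^T(x_1,…,x_n) = ∑_{g ∈ G_n} ∏_{{i,j} ∈ E_g} (e^{-βV(x_i-x_j)} - 1)`,
the sum running over all connected simple graphs on `{1,…,n}`. -/
def ursell {d : ℕ} (β : ℝ) (V : EuclideanSpace ℝ (Fin d) → ℝ) {n : ℕ}
    (x : Fin n → EuclideanSpace ℝ (Fin d)) : ℝ :=
  ∑ g ∈ (Finset.univ : Finset (SimpleGraph (Fin n))).filter (fun g => g.Connected),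
    ∏ p ∈ edgePairs g, (Real.exp (-(β * V (x p.1 - x p.2))) - 1)

/-- The `n`-th Mayer coefficient
`C_n(β,Λ) = (1/(n! |Λ|)) ∫_{Λ^n} Φ^T(x_1,…,x_n) dx_1⋯dx_n` for `n ≥ 2`, with `C_1 = 1`. -/
def mayerCoeff {d : ℕ} (β : ℝ) (V : EuclideanSpace ℝ (Fin d) → ℝ)
    (Λ : Set (EuclideanSpace ℝ (Fin d))) (n : ℕ) : ℝ :=
  if n ≤ 1 then 1
  else ((n.factorial : ℝ) * (volume Λ).toReal)⁻¹ *
    ∫ x in Set.univ.pi (fun _ : Fin n => Λ), ursell β V x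


/-! ### Rooted graph sums -/

/-- All non-loop edges with both ends in `W`. -/
def allEdges {ι : Type*} [DecidableEq ι] (W : Finset ι) : Finset (Sym2 ι) :=
  W.sym2.filter fun e => ¬ e.IsDiag

/-- Every vertex of `Y` is reachable from `X` along edges in `E`. -/
def Rooted {ι : Type*} (X Y : Finset ι) (E : Finset (Sym2 ι)) : Prop :=
  ∀ y ∈ Y, ∃ x ∈ X, Relation.ReflTransGen (fun a b => s(a, b) ∈ E) x y

/-- Sum over graphs on `X ∪ Y` in which each vertex of `Y` is connected to `X`. -/
def rootSum {ι : Type*} [DecidableEq ι] (F : Sym2 ι → ℝ) (X Y : Finset ι) : ℝ :=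
  ∑ E ∈ (allEdges (X ∪ Y)).powerset, if Rooted X Y E then ∏ e ∈ E, F e else 0

lemma mem_allEdges {ι : Type*} [DecidableEq ι] {W : Finset ι} {a b : ι} :
    s(a, b) ∈ allEdges W ↔ a ∈ W ∧ b ∈ W ∧ a ≠ b := by
  simp [allEdges, and_assoc]

lemma rootSum_empty_empty {ι : Type*} [DecidableEq ι] (F : Sym2 ι → ℝ) :
    rootSum F ∅ ∅ = 1 := by
  simp [rootSum, allEdges, Rooted]

lemma rootSum_empty {ι : Type*} [DecidableEq ι] (F : Sym2 ι → ℝ) {Y : Finset ι}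
    (hY : Y.Nonempty) : rootSum F ∅ Y = 0 := by
  obtain ⟨y, hy⟩ := hY
  refine Finset.sum_eq_zero fun E _ => if_neg fun h => ?_
  obtain ⟨x, hx, _⟩ := h y hy
  simp at hx

lemma rooted_iff {ι : Type*} [DecidableEq ι] {a : ι} {X Y T S : Finset ι}
    {E : Finset (Sym2 ι)} (haX : a ∉ X) (haY : a ∉ Y) (hT : T ⊆ X)
    (hE : E ⊆ allEdges (X ∪ Y)) :
    Rooted (insert a X) Y (E ∪ (T ∪ S).image fun z => s(a, z)) ↔ Rooted (X ∪ S) (Y \ S) E := by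
  constructor
  · intro h y hy
    obtain ⟨hyY, hyS⟩ := Finset.mem_sdiff.1 hy
    obtain ⟨x, hx, hxy⟩ := h y hyY
    have key : y = a ∨ ∃ x ∈ X ∪ S, Relation.ReflTransGen (fun a b => s(a, b) ∈ E) x y := by
      clear hy hyY hyS
      induction hxy with
      | refl =>
        rcases Finset.mem_insert.1 hx with rfl | hx
        · exact Or.inl rfl
        · exact Or.inr ⟨x, Finset.mem_union_left _ hx, .refl⟩
      | @tail v w _ hvw ih =>
        by_cases hwa : w = a
        · exact Or.inl hwa
        right
        rcases Finset.mem_union.1 hvw with hvw | hvw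
        · have hv := mem_allEdges.1 (hE hvw)
          rcases ih with rfl | ⟨x', hx', hp⟩
          · exact absurd hv.1 (by simp [haX, haY])
          · exact ⟨x', hx', hp.tail hvw⟩
        · obtain ⟨z, hz, hzz⟩ := Finset.mem_image.1 hvw
          have hwz : w = z := by
            rcases Sym2.eq_iff.1 hzz with ⟨_, h2⟩ | ⟨h1, _⟩
            · exact h2.symm
            · exact absurd h1.symm hwa
          subst hwz
          refine ⟨w, ?_, .refl⟩
          rcases Finset.mem_union.1 hz with hz | hz
          · exact Finset.mem_union_left _ (hT hz)
          · exact Finset.mem_union_right _ hz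
    rcases key with rfl | h
    · exact absurd hyY haY
    · exact h
  · intro h y hy
    have hedge : ∀ z ∈ S, s(a, z) ∈ E ∪ (T ∪ S).image fun z => s(a, z) := fun z hz =>
      Finset.mem_union_right _ (Finset.mem_image.2 ⟨z, Finset.mem_union_right _ hz, rfl⟩)
    by_cases hyS : y ∈ S
    · exact ⟨a, Finset.mem_insert_self _ _, .single (hedge y hyS)⟩
    obtain ⟨x, hx, hxy⟩ := h y (Finset.mem_sdiff.2 ⟨hy, hyS⟩)
    have hxy' : Relation.ReflTransGen
        (fun b c => s(b, c) ∈ E ∪ (T ∪ S).image fun z => s(a, z)) x y :=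
      hxy.lift id fun _ _ h => Finset.mem_union_left _ h
    rcases Finset.mem_union.1 hx with hx | hx
    · exact ⟨x, Finset.mem_insert_of_mem hx, hxy'⟩
    · exact ⟨a, Finset.mem_insert_self _ _, hxy'.head (hedge x hx)⟩

lemma rootSum_insert {ι : Type*} [DecidableEq ι] (F : Sym2 ι → ℝ) {a : ι} {X Y : Finset ι}
    (haX : a ∉ X) (haY : a ∉ Y) (hXY : Disjoint X Y) :
    rootSum F (insert a X) Y = (∏ z ∈ X, (1 + F s(a, z))) *
      ∑ S ∈ Y.powerset, (∏ z ∈ S, F s(a, z)) * rootSum F (X ∪ S) (Y \ S) := by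
  have hW : ∀ S ∈ Y.powerset, (X ∪ S) ∪ (Y \ S) = X ∪ Y := by
    intro S hS
    rw [Finset.union_assoc, Finset.union_sdiff_of_subset (Finset.mem_powerset.1 hS)]
  have hR : (∏ z ∈ X, (1 + F s(a, z))) *
      ∑ S ∈ Y.powerset, (∏ z ∈ S, F s(a, z)) * rootSum F (X ∪ S) (Y \ S) =
      ∑ q ∈ X.powerset ×ˢ (Y.powerset ×ˢ (allEdges (X ∪ Y)).powerset),
        (∏ z ∈ q.1, F s(a, z)) * ((∏ z ∈ q.2.1, F s(a, z)) *
          if Rooted (X ∪ q.2.1) (Y \ q.2.1) q.2.2 then ∏ e ∈ q.2.2, F e else 0) := by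
    rw [Finset.prod_one_add, Finset.sum_mul, Finset.sum_product]
    refine Finset.sum_congr rfl fun T _ => ?_
    rw [Finset.sum_product, Finset.mul_sum]
    refine Finset.sum_congr rfl fun S hS => ?_
    rw [rootSum, hW S hS, Finset.mul_sum, Finset.mul_sum]
  rw [hR, rootSum]
  symm
  have hnot : ∀ E ⊆ allEdges (X ∪ Y), ∀ z, s(a, z) ∉ E := by
    intro E hE z hz
    have := (mem_allEdges.1 (hE hz)).1
    simp [haX, haY] at this
  have hinj : ∀ b c, s(a, b) = s(a, c) ↔ b = c := fun b c => Sym2.congr_right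
  refine Finset.sum_nbij' (fun q => q.2.2 ∪ (q.1 ∪ q.2.1).image fun z => s(a, z))
    (fun E => (X.filter fun z => s(a, z) ∈ E, Y.filter fun z => s(a, z) ∈ E,
      E.filter fun e => a ∉ e)) ?_ ?_ ?_ ?_ ?_
  · rintro ⟨T, S, E⟩ hq
    simp only [Finset.mem_product, Finset.mem_powerset] at hq ⊢
    obtain ⟨hT, hS, hE⟩ := hq
    intro e he
    induction e using Sym2.ind with
    | _ b c =>
    rcases Finset.mem_union.1 he with he | he
    · have := mem_allEdges.1 (hE he)
      rw [mem_allEdges]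
      simp only [Finset.mem_union, Finset.mem_insert] at this ⊢
      tauto
    · obtain ⟨z, hz, hzz⟩ := Finset.mem_image.1 he
      rw [← hzz, mem_allEdges]
      have hz' : z ∈ X ∪ Y := Finset.union_subset_union hT hS hz
      have : z ≠ a := by rintro rfl; simp [haX, haY] at hz'
      simp only [Finset.mem_union, Finset.mem_insert] at hz' ⊢
      exact ⟨by tauto, by tauto, this.symm⟩
  · intro E hE
    simp only [Finset.mem_product, Finset.mem_powerset] at hE ⊢
    refine ⟨Finset.filter_subset _ _, Finset.filter_subset _ _, ?_⟩
    intro e he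
    induction e using Sym2.ind with
    | _ b c =>
    obtain ⟨he, hae⟩ := Finset.mem_filter.1 he
    have := mem_allEdges.1 (hE he)
    rw [mem_allEdges]
    simp only [Finset.mem_union, Finset.mem_insert, Sym2.mem_iff, not_or] at this hae ⊢
    grind
  · rintro ⟨T, S, E⟩ hq
    simp only [Finset.mem_product, Finset.mem_powerset] at hq
    obtain ⟨hT, hS, hE⟩ := hq
    have hd := Finset.disjoint_left.1 hXY
    ext e
    · simp only [Finset.mem_filter, Finset.mem_union, Finset.mem_image, hinj, hnot E hE]
      grind
    · simp only [Finset.mem_filter, Finset.mem_union, Finset.mem_image, hinj, hnot E hE]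
      grind
    · simp only [Finset.mem_filter, Finset.mem_union, Finset.mem_image]
      constructor
      · rintro ⟨h | ⟨z, _, rfl⟩, h2⟩
        · exact h
        · simp at h2
      · intro h
        refine ⟨Or.inl h, fun hae => ?_⟩
        obtain ⟨z, rfl⟩ := hae
        exact hnot E hE z h
  · intro E hE
    simp only [Finset.mem_powerset] at hE
    ext e
    simp only [Finset.mem_filter, Finset.mem_union, Finset.mem_image]
    constructor
    · rintro (h | ⟨z, h | h, rfl⟩)
      · exact h.1
      · exact h.2
      · exact h.2
    · intro h
      by_cases hae : a ∈ e
      · right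
        obtain ⟨z, rfl⟩ := hae
        refine ⟨z, ?_, rfl⟩
        have := mem_allEdges.1 (hE h)
        simp only [Finset.mem_union, Finset.mem_insert] at this
        grind
      · exact Or.inl ⟨h, hae⟩
  · rintro ⟨T, S, E⟩ hq
    simp only [Finset.mem_product, Finset.mem_powerset] at hq
    obtain ⟨hT, hS, hE⟩ := hq
    simp only [rooted_iff haX haY hT hE]
    split_ifs
    · rw [Finset.prod_union, Finset.prod_image, Finset.prod_union]
      · ring
      · exact Finset.disjoint_of_subset_left hT (Finset.disjoint_of_subset_right hS hXY)
      · intro b _ c _ h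
        exact (hinj b c).1 h
      · rw [Finset.disjoint_left]
        intro e he he'
        obtain ⟨z, _, rfl⟩ := Finset.mem_image.1 he'
        exact hnot E hE z he
    · simp

/-! ### The numbers of rooted forests -/

/-- The number `m (m+n)^(n-1)` of forests on `m + n` vertices with `m` given roots. -/
def forestNum (m n : ℕ) : ℕ := if n = 0 then 1 else m * (m + n) ^ (n - 1)

lemma forestNum_succ (k n : ℕ) :
    ∑ s ∈ Finset.range (n + 1), n.choose s * forestNum (k + s) (n - s) = forestNum (k + 1) n := by
  rcases Nat.eq_zero_or_pos n with rfl | hn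
  · simp [forestNum]
  have hM : 0 < k + n := by omega
  apply Nat.eq_of_mul_eq_mul_left hM
  obtain ⟨M, hMd⟩ : ∃ M, M = k + n := ⟨_, rfl⟩
  have h1 : ∀ s ∈ Finset.range (n + 1), (k + n) * (n.choose s * forestNum (k + s) (n - s)) =
      n.choose s * (k + s) * M ^ (n - s) := by
    intro s hs
    have hs' : s ≤ n := Nat.lt_succ_iff.1 (Finset.mem_range.1 hs)
    unfold forestNum
    split_ifs with h
    · have : s = n := by omega
      subst this
      simp
      try ring
    · obtain ⟨t, ht⟩ : ∃ t, n - s = t + 1 := ⟨n - s - 1, by omega⟩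
      have h2 : k + s + (t + 1) = M := by omega
      rw [ht, h2, ← hMd, pow_succ]
      simp only [Nat.add_sub_cancel]
      ring
  rw [Finset.mul_sum, Finset.sum_congr rfl h1]
  obtain ⟨p, rfl⟩ : ∃ p, n = p + 1 := ⟨n - 1, by omega⟩
  have e1 : ∑ s ∈ Finset.range (p + 1 + 1), (p + 1).choose s * M ^ (p + 1 - s) =
      (M + 1) ^ (p + 1) := by
    rw [add_comm M 1, add_pow]
    refine Finset.sum_congr rfl fun s _ => ?_
    simp
    try ring
  have e2 : ∑ s ∈ Finset.range (p + 1 + 1), (p + 1).choose s * s * M ^ (p + 1 - s) =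
      (p + 1) * (M + 1) ^ p := by
    rw [Finset.sum_range_succ', add_comm M 1, add_pow, Finset.mul_sum]
    simp only [mul_zero, zero_mul, add_zero]
    refine Finset.sum_congr rfl fun s _ => ?_
    have := Nat.add_one_mul_choose_eq p s
    rw [← this, Nat.add_sub_add_right]
    simp
    try ring
  have e3 : ∀ s, (p + 1).choose s * (k + s) * M ^ (p + 1 - s) =
      k * ((p + 1).choose s * M ^ (p + 1 - s)) + (p + 1).choose s * s * M ^ (p + 1 - s) := by
    intro s; ring
  rw [Finset.sum_congr rfl fun s _ => e3 s, Finset.sum_add_distrib, ← Finset.mul_sum, e1, e2]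
  have h4 : k + 1 + (p + 1) = M + 1 := by omega
  simp only [forestNum, h4, Nat.add_sub_cancel, ← hMd]
  rw [if_neg (by omega), hMd]
  ring

lemma forestNum_powerset {ι : Type*} [DecidableEq ι] (k : ℕ) (Y : Finset ι) :
    ∑ S ∈ Y.powerset, forestNum (k + S.card) (Y.card - S.card) = forestNum (k + 1) Y.card := by
  rw [Finset.sum_powerset_apply_card (fun s => forestNum (k + s) (Y.card - s)),
    ← forestNum_succ]
  simp

/-! ### Marginal integrals -/

open scoped ENNReal

lemma enorm_finset_prod {κ : Type*} (t : Finset κ) (g : κ → ℝ) :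
    ‖∏ k ∈ t, g k‖ₑ = ∏ k ∈ t, ‖g k‖ₑ := by
  induction t using Finset.cons_induction with
  | empty => simp
  | cons a t ha ih => rw [Finset.prod_cons, Finset.prod_cons, enorm_mul, ih]

section Helpers

variable {ι : Type*} [DecidableEq ι] {M : Type*} [MeasurableSpace M] (μ : Measure M)

lemma lmarginal_const_mul_of {s : Finset ι} {g c : (ι → M) → ℝ≥0∞} (hg : Measurable g)
    (x : ι → M) (hc : ∀ y, c (Function.updateFinset x s y) = c x) :
    lmarginal (fun _ => μ) s (fun x => c x * g x) x = c x * lmarginal (fun _ => μ) s g x := by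
  have hm : Measurable fun y : s → M => g (Function.updateFinset x s y) :=
    hg.comp measurable_updateFinset
  unfold lmarginal
  rw [← lintegral_const_mul _ hm]
  refine lintegral_congr fun y => ?_
  simp only [hc]

lemma lmarginal_mul_const_of {s : Finset ι} {g : (ι → M) → ℝ≥0∞} (hg : Measurable g)
    (c : ℝ≥0∞) (x : ι → M) :
    lmarginal (fun _ => μ) s (fun x => g x * c) x = lmarginal (fun _ => μ) s g x * c := by
  have hm : Measurable fun y : s → M => g (Function.updateFinset x s y) :=
    hg.comp measurable_updateFinset
  unfold lmarginal
  rw [← lintegral_mul_const _ hm]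

lemma lmarginal_finsetSum_of {κ : Type*} {s : Finset ι} (t : Finset κ)
    {g : κ → (ι → M) → ℝ≥0∞} (hg : ∀ k, Measurable (g k)) (x : ι → M) :
    lmarginal (fun _ => μ) s (fun x => ∑ k ∈ t, g k x) x =
      ∑ k ∈ t, lmarginal (fun _ => μ) s (g k) x := by
  have hm : ∀ k, Measurable fun y : s → M => g k (Function.updateFinset x s y) :=
    fun k => (hg k).comp measurable_updateFinset
  unfold lmarginal
  rw [← lintegral_finsetSum _ fun k _ => hm k]

end Helpers

/-- Edge weights attached to a configuration. -/
def wt {d : ℕ} (f : EuclideanSpace ℝ (Fin d) → ℝ) (hf : ∀ z, f (-z) = f z) {ι : Type*}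
    (x : ι → EuclideanSpace ℝ (Fin d)) : Sym2 ι → ℝ :=
  Sym2.lift ⟨fun i j => f (x i - x j), fun i j => by
    change f (x i - x j) = f (x j - x i)
    rw [← hf, neg_sub]⟩

@[simp] lemma wt_mk {d : ℕ} (f : EuclideanSpace ℝ (Fin d) → ℝ) (hf : ∀ z, f (-z) = f z)
    {ι : Type*} (x : ι → EuclideanSpace ℝ (Fin d)) (i j : ι) :
    wt f hf x s(i, j) = f (x i - x j) := rfl

lemma measurable_wt {d : ℕ} {f : EuclideanSpace ℝ (Fin d) → ℝ} (hf : ∀ z, f (-z) = f z)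
    (hfm : Measurable f) {ι : Type*} (e : Sym2 ι) :
    Measurable (fun x : ι → EuclideanSpace ℝ (Fin d) => wt f hf x e) := by
  induction e using Sym2.ind with
  | _ a b =>
  simp only [wt_mk]
  exact hfm.comp ((measurable_pi_apply a).sub (measurable_pi_apply b))

lemma measurable_rootSum {d : ℕ} {f : EuclideanSpace ℝ (Fin d) → ℝ} (hf : ∀ z, f (-z) = f z)
    (hfm : Measurable f) {ι : Type*} [DecidableEq ι] (X Y : Finset ι) :
    Measurable (fun x : ι → EuclideanSpace ℝ (Fin d) => rootSum (wt f hf x) X Y) := by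
  unfold rootSum
  refine Finset.measurable_fun_sum _ fun E _ => ?_
  split_ifs
  · exact Finset.measurable_fun_prod _ fun e _ => measurable_wt hf hfm e
  · exact measurable_const

lemma lmarginal_prod_le {d : ℕ} {f : EuclideanSpace ℝ (Fin d) → ℝ}
    (hfm : Measurable f) {ι : Type*} [DecidableEq ι] (a : ι) (S : Finset ι) (haS : a ∉ S)
    (x : ι → EuclideanSpace ℝ (Fin d)) :
    lmarginal (fun _ => volume) S
      (fun x : ι → EuclideanSpace ℝ (Fin d) => ∏ z ∈ S, ‖f (x a - x z)‖ₑ) x =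
      (∫⁻ z, ‖f z‖ₑ) ^ S.card := by
  have hm : ∀ z, Measurable (fun x : ι → EuclideanSpace ℝ (Fin d) => ‖f (x a - x z)‖ₑ) :=
    fun z => (hfm.comp ((measurable_pi_apply a).sub (measurable_pi_apply z))).enorm
  induction S using Finset.induction_on generalizing x with
  | empty => simp
  | insert i s hi ih =>
    have hai : a ≠ i := fun h => haS (by simp [h])
    have has : a ∉ s := fun h => haS (by simp [h])
    rw [lmarginal_insert _ (Finset.measurable_fun_prod _ fun z _ => hm z) hi]
    have : ∀ y : EuclideanSpace ℝ (Fin d), lmarginal (fun _ => volume) s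
        (fun x : ι → EuclideanSpace ℝ (Fin d) => ∏ z ∈ insert i s, ‖f (x a - x z)‖ₑ)
          (Function.update x i y) = ‖f (x a - y)‖ₑ * (∫⁻ z, ‖f z‖ₑ) ^ s.card := by
      intro y
      have h0 := lmarginal_const_mul_of (volume : Measure (EuclideanSpace ℝ (Fin d))) (s := s)
        (g := fun x => ∏ z ∈ s, ‖f (x a - x z)‖ₑ) (c := fun x => ‖f (x a - x i)‖ₑ)
        (Finset.measurable_fun_prod _ fun z _ => hm z) (Function.update x i y)
        (by intro w; simp [Function.updateFinset, hi, has])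
      rw [ih has (Function.update x i y)] at h0
      simp only [Finset.prod_insert hi]
      rw [h0]
      simp [hai]
    simp_rw [this]
    have hm2 : Measurable fun y => ‖f (x a - y)‖ₑ :=
      (hfm.comp (measurable_id.const_sub (x a))).enorm
    rw [lintegral_mul_const _ hm2,
      lintegral_sub_left_eq_self (fun z => ‖f z‖ₑ) (x a), Finset.card_insert_of_notMem hi,
      pow_succ, mul_comm]

lemma lmarginal_step {d : ℕ} {f : EuclideanSpace ℝ (Fin d) → ℝ} (hf : ∀ z, f (-z) = f z)
    (hfm : Measurable f) {ι : Type*} [DecidableEq ι] {a : ι} {X Y : Finset ι}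
    (haX : a ∉ X) (haY : a ∉ Y) (hXY : Disjoint X Y) (x : ι → EuclideanSpace ℝ (Fin d))
    (P : ℝ≥0∞) (hP : ‖∏ z ∈ X, (1 + f (x a - x z))‖ₑ ≤ P) (K : Finset ι → ℝ≥0∞)
    (hK : ∀ S ⊆ Y, ∀ x, lmarginal (fun _ => volume) (Y \ S)
      (fun x : ι → EuclideanSpace ℝ (Fin d) =>
        ‖rootSum (wt f hf x) (X ∪ S) (Y \ S)‖ₑ) x ≤ K S) :
    lmarginal (fun _ => volume) Y (fun x : ι → EuclideanSpace ℝ (Fin d) =>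
        ‖rootSum (wt f hf x) (insert a X) Y‖ₑ) x ≤
      P * ∑ S ∈ Y.powerset, (∫⁻ z, ‖f z‖ₑ) ^ S.card * K S := by
  have hm : ∀ z, Measurable (fun x : ι → EuclideanSpace ℝ (Fin d) => ‖f (x a - x z)‖ₑ) :=
    fun z => (hfm.comp ((measurable_pi_apply a).sub (measurable_pi_apply z))).enorm
  have hmp : ∀ S : Finset ι, Measurable
      (fun x : ι → EuclideanSpace ℝ (Fin d) => ∏ z ∈ S, ‖f (x a - x z)‖ₑ) :=
    fun S => Finset.measurable_fun_prod _ fun z _ => hm z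
  have hmr : ∀ S : Finset ι, Measurable (fun x : ι → EuclideanSpace ℝ (Fin d) =>
      ‖rootSum (wt f hf x) (X ∪ S) (Y \ S)‖ₑ) := fun S => (measurable_rootSum hf hfm _ _).enorm
  have hmm : ∀ S : Finset ι, Measurable (fun x : ι → EuclideanSpace ℝ (Fin d) =>
      (∏ z ∈ S, ‖f (x a - x z)‖ₑ) * ‖rootSum (wt f hf x) (X ∪ S) (Y \ S)‖ₑ) :=
    fun S => (hmp S).mul (hmr S)
  have h1 : lmarginal (fun _ => volume) Y (fun x : ι → EuclideanSpace ℝ (Fin d) =>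
        ‖rootSum (wt f hf x) (insert a X) Y‖ₑ) x ≤
      P * ∑ S ∈ Y.powerset, lmarginal (fun _ => volume) Y
        (fun x : ι → EuclideanSpace ℝ (Fin d) => (∏ z ∈ S, ‖f (x a - x z)‖ₑ) *
          ‖rootSum (wt f hf x) (X ∪ S) (Y \ S)‖ₑ) x := by
    rw [← lmarginal_finsetSum_of volume _ hmm x,
      ← lmarginal_const_mul_of volume (c := fun _ => P)
        (Finset.measurable_fun_sum _ fun S _ => hmm S) x (fun _ => rfl)]
    refine lintegral_mono fun y => ?_
    simp only
    rw [rootSum_insert _ haX haY hXY, enorm_mul]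
    refine mul_le_mul' ?_ ?_
    · refine le_of_eq_of_le ?_ hP
      congr 1
      refine Finset.prod_congr rfl fun z hz => ?_
      have : z ∉ Y := Finset.disjoint_left.1 hXY hz
      simp [Function.updateFinset, haY, this]
    · refine (enorm_sum_le _ _).trans_eq (Finset.sum_congr rfl fun S _ => ?_)
      rw [enorm_mul, enorm_finset_prod]
      rfl
  refine h1.trans (mul_le_mul' le_rfl (Finset.sum_le_sum fun S hS => ?_))
  have hSY := Finset.mem_powerset.1 hS
  have haS : a ∉ S := fun h => haY (hSY h)
  have hun : S ∪ (Y \ S) = Y := Finset.union_sdiff_of_subset hSY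
  calc _ = lmarginal (fun _ => volume) (S ∪ (Y \ S))
        (fun x : ι → EuclideanSpace ℝ (Fin d) => (∏ z ∈ S, ‖f (x a - x z)‖ₑ) *
          ‖rootSum (wt f hf x) (X ∪ S) (Y \ S)‖ₑ) x := by rw [hun]
    _ = lmarginal (fun _ => volume) S (lmarginal (fun _ => volume) (Y \ S)
        (fun x : ι → EuclideanSpace ℝ (Fin d) => (∏ z ∈ S, ‖f (x a - x z)‖ₑ) *
          ‖rootSum (wt f hf x) (X ∪ S) (Y \ S)‖ₑ)) x := by
        rw [lmarginal_union _ _ (hmm S) Finset.disjoint_sdiff]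
    _ ≤ lmarginal (fun _ => volume) S (fun x : ι → EuclideanSpace ℝ (Fin d) =>
          (∏ z ∈ S, ‖f (x a - x z)‖ₑ) * K S) x := by
        refine lmarginal_mono (fun x => ?_) x
        refine le_trans (le_of_eq ?_) (mul_le_mul' le_rfl (hK S hSY x))
        refine lmarginal_const_mul_of volume (c := fun x => ∏ z ∈ S, ‖f (x a - x z)‖ₑ)
          (hmr S) x fun w => ?_
        refine Finset.prod_congr rfl fun z hz => ?_
        simp [Function.updateFinset, haY, hz]
    _ = _ := by
        rw [← lmarginal_prod_le hfm a S haS x]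
        rw [lmarginal_mul_const_of volume (hmp S)]

lemma sum_powerset_bound {ι : Type*} [DecidableEq ι] (k : ℕ) (Y : Finset ι) (C D : ℝ≥0∞) :
    ∑ S ∈ Y.powerset, C ^ S.card *
      (D * (forestNum (k + S.card) (Y.card - S.card) : ℝ≥0∞) * C ^ (Y.card - S.card)) =
      D * (forestNum (k + 1) Y.card : ℝ≥0∞) * C ^ Y.card := by
  rw [← forestNum_powerset, Nat.cast_sum, Finset.mul_sum, Finset.sum_mul]
  refine Finset.sum_congr rfl fun S hS => ?_
  have := Finset.card_le_card (Finset.mem_powerset.1 hS)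
  conv_rhs => rw [← Nat.add_sub_of_le this, pow_add]
  rw [Nat.add_sub_of_le this]
  ring

lemma card_union_sub {ι : Type*} [DecidableEq ι] {X Y S : Finset ι} (hXY : Disjoint X Y)
    (hS : S ⊆ Y) : (X ∪ S).card = X.card + S.card :=
  Finset.card_union_of_disjoint (Finset.disjoint_of_subset_right hS hXY)

/-- The main induction. -/
lemma lmarginal_bound {d : ℕ} {f : EuclideanSpace ℝ (Fin d) → ℝ} (hf : ∀ z, f (-z) = f z)
    (hfm : Measurable f) {ι : Type*} [DecidableEq ι] (D : ℝ≥0∞) (hD : 1 ≤ D)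
    (hst : ∀ (X : Finset ι) (x : ι → EuclideanSpace ℝ (Fin d)), 2 ≤ X.card →
      ∃ a ∈ X, ‖∏ z ∈ X.erase a, (1 + f (x a - x z))‖ₑ ≤ D) (N : ℕ) :
    ∀ (X Y : Finset ι), Disjoint X Y → X.card + Y.card = N →
      ∀ x : ι → EuclideanSpace ℝ (Fin d),
      lmarginal (fun _ => volume) Y (fun x : ι → EuclideanSpace ℝ (Fin d) =>
        ‖rootSum (wt f hf x) X Y‖ₑ) x ≤
      D ^ (N - 1) * (forestNum X.card Y.card : ℝ≥0∞) * (∫⁻ z, ‖f z‖ₑ) ^ Y.card := by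
  induction N with
  | zero =>
    intro X Y _ hN x
    obtain rfl : X = ∅ := Finset.card_eq_zero.1 (by omega)
    obtain rfl : Y = ∅ := Finset.card_eq_zero.1 (by omega)
    simp [rootSum_empty_empty, forestNum]
  | succ N ih =>
    intro X Y hXY hN x
    rcases X.eq_empty_or_nonempty with rfl | hX
    · have hY : Y.Nonempty := Finset.card_pos.1 (by simp at hN; omega)
      simp only [rootSum_empty _ hY, enorm_zero]
      unfold lmarginal
      simp
    have hstep : ∃ a ∈ X, ∃ P : ℝ≥0∞, ‖∏ z ∈ X.erase a, (1 + f (x a - x z))‖ₑ ≤ P ∧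
        P * D ^ (N - 1) ≤ D ^ N := by
      rcases Nat.lt_or_ge X.card 2 with h | h
      · obtain ⟨a, rfl⟩ := Finset.card_eq_one.1
          (le_antisymm (Nat.lt_succ_iff.1 h) (Finset.card_pos.2 hX))
        refine ⟨a, by simp, 1, by simp, ?_⟩
        rw [one_mul]
        exact pow_le_pow_right₀ hD (by omega)
      · obtain ⟨a, ha, hP⟩ := hst X x h
        refine ⟨a, ha, D, hP, ?_⟩
        rw [← pow_succ']
        exact le_of_eq (congrArg _ (by omega))
    obtain ⟨a, ha, P, hP, hPD⟩ := hstep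
    have haY : a ∉ Y := Finset.disjoint_left.1 hXY ha
    have hXY' : Disjoint (X.erase a) Y := Finset.disjoint_of_subset_left (Finset.erase_subset _ _) hXY
    have hc : (X.erase a).card + 1 = X.card := Finset.card_erase_add_one ha
    have := lmarginal_step hf hfm (Finset.notMem_erase a X) haY hXY' x P hP
      (fun S => D ^ (N - 1) * (forestNum ((X.erase a).card + S.card) (Y.card - S.card) : ℝ≥0∞) *
        (∫⁻ z, ‖f z‖ₑ) ^ (Y.card - S.card)) (by
      intro S hS x
      have h1 := card_union_sub hXY' hS
      have h2 := Finset.card_sdiff_of_subset hS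
      have h3 := Finset.card_le_card hS
      have := ih (X.erase a ∪ S) (Y \ S) (by
        rw [Finset.disjoint_union_left]
        exact ⟨Finset.disjoint_of_subset_right Finset.sdiff_subset hXY', Finset.disjoint_sdiff⟩)
        (by omega) x
      rwa [h1, h2] at this)
    rw [Finset.insert_erase ha] at this
    rw [sum_powerset_bound, hc] at this
    refine this.trans ?_
    rw [← mul_assoc, ← mul_assoc, Nat.add_sub_cancel]
    gcongr

lemma lmarginal_bound_one {d : ℕ} {f : EuclideanSpace ℝ (Fin d) → ℝ} (hf : ∀ z, f (-z) = f z)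
    (hfm : Measurable f) {ι : Type*} [DecidableEq ι] (D : ℝ≥0∞) (hD : 1 ≤ D)
    (hst : ∀ (X : Finset ι) (x : ι → EuclideanSpace ℝ (Fin d)), 2 ≤ X.card →
      ∃ a ∈ X, ‖∏ z ∈ X.erase a, (1 + f (x a - x z))‖ₑ ≤ D)
    (a : ι) (Y : Finset ι) (haY : a ∉ Y) (x : ι → EuclideanSpace ℝ (Fin d)) :
      lmarginal (fun _ => volume) Y (fun x : ι → EuclideanSpace ℝ (Fin d) =>
        ‖rootSum (wt f hf x) {a} Y‖ₑ) x ≤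
      D ^ (Y.card - 1) * (forestNum 1 Y.card : ℝ≥0∞) * (∫⁻ z, ‖f z‖ₑ) ^ Y.card := by
  have := lmarginal_step hf hfm (Finset.notMem_empty a) haY (Finset.disjoint_empty_left _) x 1
    (by simp)
    (fun S => D ^ (Y.card - 1) * (forestNum (0 + S.card) (Y.card - S.card) : ℝ≥0∞) *
        (∫⁻ z, ‖f z‖ₑ) ^ (Y.card - S.card)) (by
      intro S hS x
      have h2 := Finset.card_sdiff_of_subset hS
      have h3 := Finset.card_le_card hS
      have := lmarginal_bound hf hfm D hD hst Y.card (∅ ∪ S) (Y \ S) (by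
        rw [Finset.empty_union]; exact Finset.disjoint_sdiff)
        (by rw [Finset.empty_union]; omega) x
      rw [h2, Finset.empty_union] at this
      simpa using this)
  rw [sum_powerset_bound, one_mul] at this
  simpa using this

/-! ### Stability -/

lemma two_mul_pairEnergy {d : ℕ} (V : EuclideanSpace ℝ (Fin d) → ℝ)
    (hVsymm : ∀ x, V (-x) = V x) {n : ℕ} (y : Fin n → EuclideanSpace ℝ (Fin d)) :
    ∑ i, ∑ j, (if j = i then 0 else V (y i - y j)) = 2 * pairEnergy V y := by
  have h1 : pairEnergy V y = ∑ i, ∑ j, if i < j then V (y i - y j) else 0 := by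
    rw [pairEnergy, Finset.sum_filter, Fintype.sum_prod_type]
  have h2 : pairEnergy V y = ∑ i, ∑ j, if j < i then V (y i - y j) else 0 := by
    rw [h1, Finset.sum_comm]
    refine Finset.sum_congr rfl fun i _ => Finset.sum_congr rfl fun j _ => ?_
    rw [← hVsymm (y j - y i), neg_sub]
  rw [two_mul]
  nth_rewrite 1 [h1]
  rw [h2, ← Finset.sum_add_distrib]
  refine Finset.sum_congr rfl fun i _ => ?_
  rw [← Finset.sum_add_distrib]
  refine Finset.sum_congr rfl fun j _ => ?_
  rcases lt_trichotomy i j with h | h | h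
  · simp [h, h.ne', h.not_gt]
  · simp [h]
  · simp [h, h.ne, h.not_gt]

lemma exists_stable_point {d : ℕ} (B : ℝ) (V : EuclideanSpace ℝ (Fin d) → ℝ)
    (hVsymm : ∀ x, V (-x) = V x)
    (hstab : ∀ (n : ℕ), 2 ≤ n → ∀ x : Fin n → EuclideanSpace ℝ (Fin d),
      -(B * n) ≤ pairEnergy V x) {ι : Type*} [DecidableEq ι] (X : Finset ι)
    (x : ι → EuclideanSpace ℝ (Fin d)) (hX : 2 ≤ X.card) :
    ∃ a ∈ X, -(2 * B) ≤ ∑ z ∈ X.erase a, V (x a - x z) := by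
  by_contra! hcon
  have hne : X.Nonempty := Finset.card_pos.1 (by omega)
  have hlt := Finset.sum_lt_sum_of_nonempty hne hcon
  let e := X.equivFin.symm
  have hs := hstab X.card hX (fun i => x (e i))
  have h2 := two_mul_pairEnergy V hVsymm (fun i => x (e i))
  have hconv : ∀ g : ι → ℝ, ∑ a ∈ X, g a = ∑ i, g (e i) := by
    intro g
    rw [← Finset.sum_coe_sort, ← Equiv.sum_comp e]
  have h3 : ∑ a ∈ X, ∑ z ∈ X.erase a, V (x a - x z) =
      ∑ i, ∑ j, (if j = i then 0 else V (x (e i) - x (e j))) := by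
    rw [hconv]
    refine Finset.sum_congr rfl fun i _ => ?_
    have : ∑ z ∈ X.erase (e i : ι), V (x (e i) - x z) =
        ∑ z ∈ X, if z = (e i : ι) then 0 else V (x (e i) - x z) := by
      rw [← Finset.filter_ne', Finset.sum_filter]
      refine Finset.sum_congr rfl fun z _ => ?_
      by_cases h : z = (e i : ι) <;> simp [h]
    rw [this, hconv]
    refine Finset.sum_congr rfl fun j _ => ?_
    by_cases h : j = i
    · simp [h]
    · have : (e j : ι) ≠ (e i : ι) := fun h' => h (e.injective (Subtype.ext h'))
      simp [h, this]
  rw [h3, h2] at hlt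
  simp at hlt
  nlinarith

/-! ### The Ursell function as a rooted sum -/

lemma ursell_eq_rootSum {d : ℕ} (β : ℝ) (V : EuclideanSpace ℝ (Fin d) → ℝ)
    (f : EuclideanSpace ℝ (Fin d) → ℝ) (hfd : ∀ z, f z = Real.exp (-(β * V z)) - 1)
    (hf : ∀ z, f (-z) = f z) {n : ℕ} (a : Fin n) (x : Fin n → EuclideanSpace ℝ (Fin d)) :
    ursell β V x = rootSum (wt f hf x) {a} (Finset.univ.erase a) := by
  have hU : ({a} : Finset (Fin n)) ∪ Finset.univ.erase a = Finset.univ := by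
    ext z; by_cases h : z = a <;> simp [h]
  rw [rootSum, hU, ← Finset.sum_filter, ursell]
  have hconn : ∀ G : SimpleGraph (Fin n), G.Connected ↔
      Rooted {a} (Finset.univ.erase a) G.edgeFinset := by
    intro G
    have hrt : ∀ y, G.Reachable a y ↔
        Relation.ReflTransGen (fun b c => s(b, c) ∈ G.edgeFinset) a y := by
      intro y
      rw [SimpleGraph.reachable_iff_reflTransGen]
      simp [SimpleGraph.mem_edgeFinset]
    constructor
    · intro h y _
      exact ⟨a, by simp, (hrt y).1 (h.preconnected a y)⟩
    · intro h
      have hr : ∀ y, G.Reachable a y := by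
        intro y
        by_cases hy : y = a
        · rw [hy]
        · obtain ⟨b, hb, hp⟩ := h y (by simp [hy])
          rw [Finset.mem_singleton] at hb
          subst hb
          exact (hrt y).2 hp
      have : Nonempty (Fin n) := ⟨a⟩
      exact ⟨fun u v => (hr u).symm.trans (hr v)⟩
  have hback : ∀ E ∈ (allEdges (Finset.univ : Finset (Fin n))).powerset,
      ∀ (_ : Fintype (SimpleGraph.fromEdgeSet (E : Set (Sym2 (Fin n)))).edgeSet),
      (SimpleGraph.fromEdgeSet (E : Set (Sym2 (Fin n)))).edgeFinset = E := by
    intro E hE _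
    ext e
    rw [SimpleGraph.mem_edgeFinset, SimpleGraph.edgeSet_fromEdgeSet]
    induction e using Sym2.ind with
    | _ b c =>
    constructor
    · intro h; exact h.1
    · intro h
      refine ⟨h, ?_⟩
      have := (mem_allEdges.1 (Finset.mem_powerset.1 hE h)).2.2
      simpa using this
  refine Finset.sum_nbij' (fun G => G.edgeFinset)
    (fun E => SimpleGraph.fromEdgeSet (E : Set (Sym2 (Fin n)))) ?_ ?_ ?_ ?_ ?_
  · intro G hG
    rw [Finset.mem_filter] at hG ⊢
    refine ⟨Finset.mem_powerset.2 fun e he => ?_, (hconn G).1 hG.2⟩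
    induction e using Sym2.ind with
    | _ b c =>
    rw [SimpleGraph.mem_edgeFinset, SimpleGraph.mem_edgeSet] at he
    exact mem_allEdges.2 ⟨Finset.mem_univ _, Finset.mem_univ _, he.ne⟩
  · intro E hE
    rw [Finset.mem_filter] at hE ⊢
    refine ⟨Finset.mem_univ _, (hconn _).2 ?_⟩
    convert hE.2
    exact hback E hE.1 _
  · intro G _
    simp
  · intro E hE
    exact hback E (Finset.mem_filter.1 hE).1 _
  · intro G _
    refine Finset.prod_bij (fun p _ => s(p.1, p.2)) ?_ ?_ ?_ ?_
    · intro p hp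
      simp only [edgePairs, Finset.mem_filter] at hp
      rw [SimpleGraph.mem_edgeFinset, SimpleGraph.mem_edgeSet]
      exact hp.2.2
    · rintro ⟨p1, p2⟩ hp ⟨q1, q2⟩ hq h
      simp only [edgePairs, Finset.mem_filter] at hp hq
      rcases Sym2.eq_iff.1 h with ⟨h1, h2⟩ | ⟨h1, h2⟩
      · simp only at h1 h2
        rw [h1, h2]
      · simp only at h1 h2
        subst h1 h2
        exact absurd hp.2.1 hq.2.1.not_gt
    · intro e he
      induction e using Sym2.ind with
      | _ b c =>
      rw [SimpleGraph.mem_edgeFinset, SimpleGraph.mem_edgeSet] at he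
      rcases lt_or_gt_of_ne he.ne with h | h
      · exact ⟨(b, c), by simp [edgePairs, h, he], rfl⟩
      · exact ⟨(c, b), by simp [edgePairs, h, he.symm], Sym2.eq_swap⟩
    · intro p _
      rw [wt_mk, hfd]

/-! ### The bound -/

lemma lintegral_ursell_le {d : ℕ} (β B : ℝ) (hβ : 0 < β) (hB : 0 ≤ B)
    (V : EuclideanSpace ℝ (Fin d) → ℝ) (hVmeas : Measurable V)
    (hVsymm : ∀ x, V (-x) = V x)
    (hstab : ∀ (n : ℕ), 2 ≤ n → ∀ x : Fin n → EuclideanSpace ℝ (Fin d),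
      -(B * n) ≤ pairEnergy V x)
    (Λ : Set (EuclideanSpace ℝ (Fin d))) (hΛmeas : MeasurableSet Λ) (n : ℕ) (hn : 2 ≤ n) :
    ∫⁻ x in Set.univ.pi (fun _ : Fin n => Λ), ‖ursell β V x‖ₑ ≤
      volume Λ * (ENNReal.ofReal (Real.exp (2 * β * B)) ^ (n - 2) * ((n ^ (n - 2) : ℕ) : ℝ≥0∞) *
        (∫⁻ z, ‖Real.exp (-(β * V z)) - 1‖ₑ) ^ (n - 1)) := by
  obtain ⟨f, hfd⟩ : ∃ f : EuclideanSpace ℝ (Fin d) → ℝ,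
    ∀ z, f z = Real.exp (-(β * V z)) - 1 := ⟨_, fun _ => rfl⟩
  have hf : ∀ z, f (-z) = f z := fun z => by rw [hfd, hfd, hVsymm]
  have hfm : Measurable f := by
    rw [funext hfd]
    exact ((hVmeas.const_mul β).neg.exp).sub_const 1
  have hst : ∀ (X : Finset (Fin n)) (x : Fin n → EuclideanSpace ℝ (Fin d)), 2 ≤ X.card →
      ∃ a ∈ X, ‖∏ z ∈ X.erase a, (1 + f (x a - x z))‖ₑ ≤
        ENNReal.ofReal (Real.exp (2 * β * B)) := by
    intro X x hX
    obtain ⟨a, ha, h⟩ := exists_stable_point B V hVsymm hstab X x hX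
    refine ⟨a, ha, ?_⟩
    have : ∏ z ∈ X.erase a, (1 + f (x a - x z)) =
        Real.exp (-(β * ∑ z ∈ X.erase a, V (x a - x z))) := by
      rw [Finset.mul_sum, ← Finset.sum_neg_distrib, Real.exp_sum]
      refine Finset.prod_congr rfl fun z _ => ?_
      rw [hfd]; ring
    rw [this, Real.enorm_eq_ofReal (Real.exp_pos _).le]
    refine ENNReal.ofReal_le_ofReal (Real.exp_le_exp.2 ?_)
    nlinarith
  have hD : 1 ≤ ENNReal.ofReal (Real.exp (2 * β * B)) := by
    rw [ENNReal.one_le_ofReal]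
    exact Real.one_le_exp (by positivity)
  let a : Fin n := ⟨0, by omega⟩
  have hcard : (Finset.univ.erase a).card = n - 1 := by
    rw [Finset.card_erase_of_mem (Finset.mem_univ _)]; simp
  have hK := lmarginal_bound_one hf hfm _ hD hst a (Finset.univ.erase a)
    (Finset.notMem_erase _ _)
  have hfn : forestNum 1 (n - 1) = n ^ (n - 2) := by
    rw [forestNum, if_neg (by omega), one_mul]
    congr 1
    omega
  rw [hcard, hfn, show n - 1 - 1 = n - 2 by omega] at hK
  simp_rw [← hfd]
  obtain ⟨K, hKd⟩ : ∃ K, K = ENNReal.ofReal (Real.exp (2 * β * B)) ^ (n - 2) *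
    ((n ^ (n - 2) : ℕ) : ℝ≥0∞) * (∫⁻ z, ‖f z‖ₑ) ^ (n - 1) := ⟨_, rfl⟩
  rw [← hKd] at hK ⊢
  simp_rw [ursell_eq_rootSum β V f hfd hf a]
  have hmr : Measurable (fun x : Fin n → EuclideanSpace ℝ (Fin d) =>
      ‖rootSum (wt f hf x) {a} (Finset.univ.erase a)‖ₑ) := (measurable_rootSum hf hfm _ _).enorm
  have hmi : Measurable (fun x : Fin n → EuclideanSpace ℝ (Fin d) =>
      Λ.indicator (fun _ => (1 : ℝ≥0∞)) (x a)) :=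
    (measurable_const.indicator hΛmeas).comp (measurable_pi_apply a)
  have hmm : Measurable (fun x : Fin n → EuclideanSpace ℝ (Fin d) =>
      Λ.indicator (fun _ => (1 : ℝ≥0∞)) (x a) *
        ‖rootSum (wt f hf x) {a} (Finset.univ.erase a)‖ₑ) := hmi.mul hmr
  calc _ = ∫⁻ x, (Set.univ.pi (fun _ : Fin n => Λ)).indicator
        (fun x => ‖rootSum (wt f hf x) {a} (Finset.univ.erase a)‖ₑ) x := by
        rw [lintegral_indicator (MeasurableSet.univ_pi fun _ => hΛmeas)]
    _ ≤ ∫⁻ x : Fin n → EuclideanSpace ℝ (Fin d), Λ.indicator (fun _ => (1 : ℝ≥0∞)) (x a) *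
        ‖rootSum (wt f hf x) {a} (Finset.univ.erase a)‖ₑ := by
        refine lintegral_mono fun x => ?_
        by_cases hx : x ∈ Set.univ.pi (fun _ : Fin n => Λ)
        · have : x a ∈ Λ := hx a trivial
          simp [hx, this]
        · simp only [Set.indicator_of_notMem hx]
          exact zero_le
    _ = lmarginal (fun _ => volume) {a} (lmarginal (fun _ => volume) (Finset.univ.erase a)
          (fun x : Fin n → EuclideanSpace ℝ (Fin d) => Λ.indicator (fun _ => (1 : ℝ≥0∞)) (x a) *
        ‖rootSum (wt f hf x) {a} (Finset.univ.erase a)‖ₑ)) 0 := by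
        rw [← lmarginal_union _ _ hmm (by simp)]
        have hU : ({a} : Finset (Fin n)) ∪ Finset.univ.erase a = Finset.univ := by
          ext z; by_cases h : z = a <;> simp [h]
        rw [hU, lmarginal_univ]
        rfl
    _ ≤ lmarginal (fun _ => volume) {a} (fun x : Fin n → EuclideanSpace ℝ (Fin d) =>
          Λ.indicator (fun _ => (1 : ℝ≥0∞)) (x a) * K) 0 := by
        refine lmarginal_mono (fun x => ?_) 0
        rw [lmarginal_const_mul_of volume
          (c := fun x => Λ.indicator (fun _ => (1 : ℝ≥0∞)) (x a)) hmr x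
          (by intro y; simp [Function.updateFinset])]
        exact mul_le_mul' le_rfl (hK x)
    _ = volume Λ * K := by
        rw [lmarginal_mul_const_of volume hmi, lmarginal_singleton]
        simp [lintegral_indicator hΛmeas]

lemma mayerCoeff_le {d : ℕ} (β B : ℝ) (hβ : 0 < β) (hB : 0 ≤ B)
    (V : EuclideanSpace ℝ (Fin d) → ℝ) (hVmeas : Measurable V)
    (hVsymm : ∀ x, V (-x) = V x)
    (hstab : ∀ (n : ℕ), 2 ≤ n → ∀ x : Fin n → EuclideanSpace ℝ (Fin d),
      -(B * n) ≤ pairEnergy V x)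
    (hC : Integrable (fun x : EuclideanSpace ℝ (Fin d) => |Real.exp (-(β * V x)) - 1|))
    (Λ : Set (EuclideanSpace ℝ (Fin d))) (hΛmeas : MeasurableSet Λ)
    (hΛbdd : Bornology.IsBounded Λ) (hΛpos : 0 < volume Λ) (n : ℕ) (hn : 2 ≤ n) :
      |mayerCoeff β V Λ n| ≤
        Real.exp (2 * β * B * ((n : ℝ) - 2)) * (n : ℝ) ^ (n - 2) *
          (∫ x : EuclideanSpace ℝ (Fin d), |Real.exp (-(β * V x)) - 1|) ^ (n - 1) /
            (n.factorial : ℝ) := by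
  have hfin : volume Λ ≠ ⊤ := hΛbdd.measure_lt_top.ne
  have hv : 0 < (volume Λ).toReal := ENNReal.toReal_pos hΛpos.ne' hfin
  have hCeq : ∫⁻ z, ‖Real.exp (-(β * V z)) - 1‖ₑ =
      ENNReal.ofReal (∫ x : EuclideanSpace ℝ (Fin d), |Real.exp (-(β * V x)) - 1|) := by
    rw [ofReal_integral_eq_lintegral_ofReal hC (Filter.Eventually.of_forall fun _ => abs_nonneg _)]
    refine lintegral_congr fun z => ?_
    rw [← Real.norm_eq_abs, ofReal_norm]
  have h := (enorm_integral_le_lintegral_enorm _).trans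
    (lintegral_ursell_le β B hβ hB V hVmeas hVsymm hstab Λ hΛmeas n hn)
  rw [hCeq] at h
  have hC0 : 0 ≤ ∫ x : EuclideanSpace ℝ (Fin d), |Real.exp (-(β * V x)) - 1| :=
    integral_nonneg fun _ => abs_nonneg _
  obtain ⟨C, hCd⟩ : ∃ C, C = ∫ x : EuclideanSpace ℝ (Fin d), |Real.exp (-(β * V x)) - 1| :=
    ⟨_, rfl⟩
  rw [← hCd] at h hC0 ⊢
  have h' : |∫ x in Set.univ.pi (fun _ : Fin n => Λ), ursell β V x| ≤ (volume Λ).toReal *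
      (Real.exp (2 * β * B) ^ (n - 2) * (n : ℝ) ^ (n - 2) * C ^ (n - 1)) := by
    have h2 := ENNReal.toReal_mono (by finiteness) h
    simpa [ENNReal.toReal_mul, ENNReal.toReal_pow, ENNReal.toReal_ofReal hC0,
      ENNReal.toReal_ofReal (Real.exp_pos _).le] using h2
  have hexp : Real.exp (2 * β * B * ((n : ℝ) - 2)) = Real.exp (2 * β * B) ^ (n - 2) := by
    rw [← Real.exp_nat_mul, Nat.cast_sub hn]
    congr 1
    push_cast
    ring
  have hfac : (0 : ℝ) < n.factorial := by exact_mod_cast n.factorial_pos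
  rw [mayerCoeff, if_neg (by omega), abs_mul, abs_of_pos (by positivity), hexp,
    le_div_iff₀ hfac]
  calc _ ≤ ((n.factorial : ℝ) * (volume Λ).toReal)⁻¹ * ((volume Λ).toReal *
      (Real.exp (2 * β * B) ^ (n - 2) * (n : ℝ) ^ (n - 2) * C ^ (n - 1))) * n.factorial := by
        gcongr
    _ = _ := by field_simp

lemma mayer_summable {c : ℕ → ℝ} {b C r : ℝ} (hb : 0 ≤ b) (hr : 0 ≤ r)
    (hC0 : 0 ≤ C)
    (hc : ∀ n : ℕ, 2 ≤ n → |c n| ≤ Real.exp (b * ((n : ℝ) - 2)) * (n : ℝ) ^ (n - 2) *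
      C ^ (n - 1) / (n.factorial : ℝ))
    (hlt : r < 1 / (Real.exp (b + 1) * C)) :
    Summable (fun n : ℕ => |c (n + 1)| * r ^ (n + 1)) := by
  have hCpos : 0 < C := by
    rcases hC0.eq_or_lt with h | h
    · rw [← h] at hlt; simp at hlt; linarith
    · exact h
  have hq : Real.exp (b + 1) * C * r < 1 := by
    rw [lt_div_iff₀ (by positivity)] at hlt
    linarith
  have hg := (summable_geometric_of_lt_one (by positivity) hq).mul_left C⁻¹
  rw [← summable_nat_add_iff 1]
  rw [← summable_nat_add_iff 2] at hg
  refine Summable.of_nonneg_of_le (fun n => by positivity) (fun n => ?_) hg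
  have hn : n + 1 + 1 = n + 2 := rfl
  rw [hn]
  have h1 := hc (n + 2) (by omega)
  have hfac : (0 : ℝ) < (n + 2).factorial := by exact_mod_cast (n + 2).factorial_pos
  have h2 : ((n + 2 : ℕ) : ℝ) ^ (n + 2 - 2) / ((n + 2).factorial : ℝ) ≤
      Real.exp ((n + 2 : ℕ) : ℝ) := by
    refine le_trans ?_ (Real.pow_div_factorial_le_exp ((n + 2 : ℕ) : ℝ) (by positivity) (n + 2))
    gcongr
    · push_cast; linarith [(Nat.cast_nonneg n : (0 : ℝ) ≤ n)]
    · omega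
  have h3 : Real.exp (b * (((n + 2 : ℕ) : ℝ) - 2)) ≤ Real.exp (b * ((n + 2 : ℕ) : ℝ)) := by
    refine Real.exp_le_exp.2 ?_
    nlinarith
  calc |c (n + 2)| * r ^ (n + 2)
      ≤ (Real.exp (b * (((n + 2 : ℕ) : ℝ) - 2)) * ((n + 2 : ℕ) : ℝ) ^ (n + 2 - 2) *
      C ^ (n + 2 - 1) / ((n + 2).factorial : ℝ)) * r ^ (n + 2) := by gcongr
    _ = Real.exp (b * (((n + 2 : ℕ) : ℝ) - 2)) *
        (((n + 2 : ℕ) : ℝ) ^ (n + 2 - 2) / ((n + 2).factorial : ℝ)) *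
        (C ^ (n + 2 - 1) * r ^ (n + 2)) := by ring
    _ ≤ Real.exp (b * ((n + 2 : ℕ) : ℝ)) * Real.exp ((n + 2 : ℕ) : ℝ) *
        (C ^ (n + 2 - 1) * r ^ (n + 2)) := by gcongr
    _ = C⁻¹ * (Real.exp (b + 1) * C * r) ^ (n + 2) := by
        rw [mul_pow, mul_pow, ← Real.exp_nat_mul, ← Real.exp_add,
          show b * ((n + 2 : ℕ) : ℝ) + ((n + 2 : ℕ) : ℝ) = ((n + 2 : ℕ) : ℝ) * (b + 1) by ring,
          show n + 2 - 1 = n + 1 by omega, pow_succ C (n + 1)]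
        field_simp

/-- Penrose–Ruelle bound: for a stable and tempered pair potential,
`|C_n(β,Λ)| ≤ e^{2βB(n-2)} n^{n-2} C(β)^{n-1}/n!`, and hence the Mayer series converges
absolutely (uniformly in `Λ`) for `|λ| < 1/(e^{2βB+1} C(β))`. -/
theorem statement9 {d : ℕ} (β B : ℝ) (hβ : 0 < β) (hB : 0 ≤ B)
    (V : EuclideanSpace ℝ (Fin d) → ℝ) (hVmeas : Measurable V)
    (hVsymm : ∀ x, V (-x) = V x)
    (hstab : ∀ (n : ℕ), 2 ≤ n → ∀ x : Fin n → EuclideanSpace ℝ (Fin d),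
      -(B * n) ≤ pairEnergy V x)
    (hC : Integrable (fun x : EuclideanSpace ℝ (Fin d) => |Real.exp (-(β * V x)) - 1|))
    (Λ : Set (EuclideanSpace ℝ (Fin d))) (hΛmeas : MeasurableSet Λ)
    (hΛbdd : Bornology.IsBounded Λ) (hΛpos : 0 < volume Λ) :
    (∀ n : ℕ, 2 ≤ n →
      |mayerCoeff β V Λ n| ≤
        Real.exp (2 * β * B * ((n : ℝ) - 2)) * (n : ℝ) ^ (n - 2) *
          (∫ x : EuclideanSpace ℝ (Fin d), |Real.exp (-(β * V x)) - 1|) ^ (n - 1) /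
            (n.factorial : ℝ)) ∧
    ∀ lam : ℂ,
      ‖lam‖ < 1 / (Real.exp (2 * β * B + 1) *
          ∫ x : EuclideanSpace ℝ (Fin d), |Real.exp (-(β * V x)) - 1|) →
        Summable (fun n : ℕ => |mayerCoeff β V Λ (n + 1)| * ‖lam‖ ^ (n + 1)) := by
  have h1 := mayerCoeff_le β B hβ hB V hVmeas hVsymm hstab hC Λ hΛmeas hΛbdd hΛpos
  refine ⟨h1, fun lam hlam => ?_⟩
  exact mayer_summable (c := mayerCoeff β V Λ) (b := 2 * β * B) (by positivity) (norm_nonneg _)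
    (integral_nonneg fun _ => abs_nonneg _) h1 hlam

end
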